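/- For compositions λ, μ of r, there is an R-module isomorphism Hom_{H^c_{r,R}}(x_μ H^c_{r,R}, x_λ H^c_{r,R}) ≅ x_λ H^c_{r,R} ∩ H^c_{r,R} x_μ, given by f ↦ f(x_μ); its inverse sends z to the homomorphism x_μ h ↦ z h. -/

import Mathlib

namespace HCPaper

noncomputable section

open MulOpposite

/-- Generators of the Hecke-Clifford superalgebra: `Sum.inl i` is `T_{i+1}` (0-based `i < r-1`),
`Sum.inr j` is `c_{j+1}` (0-based `j < r`). -/
abbrev Gen (r : ℕ) := (Fin (r - 1)) ⊕ (Fin r)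

/-- The index `i` viewed in `Fin r` (the first of the two indices moved by `T_i`). -/
def loIdx {r : ℕ} (i : Fin (r - 1)) : Fin r := ⟨i.val, by have := i.isLt; omega⟩

/-- The index `i+1` viewed in `Fin r`. -/
def hiIdx {r : ℕ} (i : Fin (r - 1)) : Fin r := ⟨i.val + 1, by have := i.isLt; omega⟩

def Tf (R : Type) [CommRing R] (r : ℕ) (i : Fin (r - 1)) : FreeAlgebra R (Gen r) :=
  FreeAlgebra.ι R (Sum.inl i)

def Cf (R : Type) [CommRing R] (r : ℕ) (j : Fin r) : FreeAlgebra R (Gen r) :=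
  FreeAlgebra.ι R (Sum.inr j)

/-- The defining relations of the Hecke-Clifford superalgebra `H^c_{r,R}`. -/
inductive HCRel (R : Type) [CommRing R] (q : R) (r : ℕ) :
    FreeAlgebra R (Gen r) → FreeAlgebra R (Gen r) → Prop
  | csq (j : Fin r) : HCRel R q r (Cf R r j * Cf R r j) (-1)
  | canti (i j : Fin r) (h : i ≠ j) :
      HCRel R q r (Cf R r i * Cf R r j) (-(Cf R r j * Cf R r i))
  | quad (i : Fin (r - 1)) :
      HCRel R q r ((Tf R r i - algebraMap R _ q) * (Tf R r i + 1)) 0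
  | commTT (i i' : Fin (r - 1)) (h : i.val + 1 < i'.val) :
      HCRel R q r (Tf R r i * Tf R r i') (Tf R r i' * Tf R r i)
  | braid (i i' : Fin (r - 1)) (h : i'.val = i.val + 1) :
      HCRel R q r (Tf R r i * Tf R r i' * Tf R r i) (Tf R r i' * Tf R r i * Tf R r i')
  | commTC (i : Fin (r - 1)) (j : Fin r) (h1 : j.val ≠ i.val) (h2 : j.val ≠ i.val + 1) :
      HCRel R q r (Tf R r i * Cf R r j) (Cf R r j * Tf R r i)
  | TClo (i : Fin (r - 1)) :
      HCRel R q r (Tf R r i * Cf R r (loIdx i)) (Cf R r (hiIdx i) * Tf R r i)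
  | TChi (i : Fin (r - 1)) :
      HCRel R q r (Tf R r i * Cf R r (hiIdx i))
        (Cf R r (loIdx i) * Tf R r i -
          algebraMap R _ (q - 1) * (Cf R r (loIdx i) - Cf R r (hiIdx i)))

/-- The Hecke-Clifford superalgebra `H^c_{r,R}` with parameter `q`, as a quotient of
the free algebra by the defining relations. -/
abbrev HC (R : Type) [CommRing R] (q : R) (r : ℕ) := RingQuot (HCRel R q r)

/-- The generator `T_{i+1}` of `H^c_{r,R}` (0-based index). -/
def TT (R : Type) [CommRing R] (q : R) (r : ℕ) (i : Fin (r - 1)) : HC R q r :=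
  RingQuot.mkAlgHom R (HCRel R q r) (Tf R r i)

/-- The generator `c_{j+1}` of `H^c_{r,R}` (0-based index). -/
def CC (R : Type) [CommRing R] (q : R) (r : ℕ) (j : Fin r) : HC R q r :=
  RingQuot.mkAlgHom R (HCRel R q r) (Cf R r j)

end

end HCPaper
namespace HCPaper

/-- The Coxeter length of a permutation of `Fin r`: its number of inversions. -/
def len {r : ℕ} (w : Equiv.Perm (Fin r)) : ℕ :=
  (Finset.univ.filter fun p : Fin r × Fin r => p.1 < p.2 ∧ w p.2 < w p.1).card

/-- The simple transposition `s_{k+1} = (k+1, k+2)` (0-based `k < r-1`) as a permutation. -/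
def simpleT {r : ℕ} (k : Fin (r - 1)) : Equiv.Perm (Fin r) :=
  Equiv.swap (loIdx k) (hiIdx k)

/-- Partial sum `λ_1 + ⋯ + λ_k` of a composition. -/
def psum {n : ℕ} (lam : Fin n → ℕ) (k : ℕ) : ℕ :=
  ∑ i : Fin n, if (i : ℕ) < k then lam i else 0

/-- `j` (0-based) lies in the `k`-th block `R^λ_{k+1}` of the composition `λ`. -/
def InBlock {n r : ℕ} (lam : Fin n → ℕ) (k : Fin n) (j : Fin r) : Prop :=
  psum lam (k : ℕ) ≤ (j : ℕ) ∧ (j : ℕ) < psum lam (k : ℕ) + lam k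

instance {n r : ℕ} (lam : Fin n → ℕ) (k : Fin n) (j : Fin r) : Decidable (InBlock lam k j) := by
  unfold InBlock; infer_instance

/-- Membership in the Young subgroup `S_λ`: `w` preserves each block of `λ`. -/
def MemYoung {n r : ℕ} (lam : Fin n → ℕ) (w : Equiv.Perm (Fin r)) : Prop :=
  ∀ (k : Fin n) (j : Fin r), InBlock lam k j → InBlock lam k (w j)

instance {n r : ℕ} (lam : Fin n → ℕ) (w : Equiv.Perm (Fin r)) : Decidable (MemYoung lam w) := by
  unfold MemYoung; infer_instance

/-- `d` is the minimal length element of the double coset `S_λ d S_μ`. -/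
def MinDouble {r n1 n2 : ℕ} (lam : Fin n1 → ℕ) (mu : Fin n2 → ℕ) (d : Equiv.Perm (Fin r)) :
    Prop :=
  ∀ u σ : Equiv.Perm (Fin r), MemYoung lam u → MemYoung mu σ → len d ≤ len (u * d * σ)

end HCPaper
namespace HCPaper

noncomputable section

/-- `TW` is the standard basis `w ↦ T_w` of the Hecke subalgebra of `H^c_{r,R}`:
`T_1 = 1` and `T_{w s_k} = T_w T_{s_k}` whenever `ℓ(w s_k) = ℓ(w) + 1`. -/
def IsTW {R : Type} [CommRing R] (q : R) (r : ℕ) (TW : Equiv.Perm (Fin r) → HC R q r) :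
    Prop :=
  TW 1 = 1 ∧ ∀ (w : Equiv.Perm (Fin r)) (k : Fin (r - 1)),
    len (w * simpleT k) = len w + 1 → TW (w * simpleT k) = TW w * TT R q r k

/-- The element `x_λ = ∑_{w ∈ S_λ} T_w` of `H^c_{r,R}`. -/
def xElt {R : Type} [CommRing R] {q : R} {r n : ℕ} (lam : Fin n → ℕ)
    (TW : Equiv.Perm (Fin r) → HC R q r) : HC R q r :=
  ∑ w : Equiv.Perm (Fin r), if MemYoung lam w then TW w else 0

/-- The element `c_{q,r} = q^{r-1} c_1 + q^{r-2} c_2 + ⋯ + c_r` of `H^c_{r,R}`. -/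
def cqr (R : Type) [CommRing R] (q : R) (r : ℕ) : HC R q r :=
  ∑ j : Fin r, q ^ (r - 1 - (j : ℕ)) • CC R q r j

/-- The element `c'_{q,r} = c_1 + q c_2 + ⋯ + q^{r-1} c_r` of `H^c_{r,R}`. -/
def cqr' (R : Type) [CommRing R] (q : R) (r : ℕ) : HC R q r :=
  ∑ j : Fin r, q ^ (j : ℕ) • CC R q r j

end

end HCPaper

namespace HCPaper

noncomputable section

/-! ### Inductions over algebras generated by a set -/

lemma gen_right_induction {R X A : Type} [CommRing R] [Ring A] [Algebra R A]
    (p : FreeAlgebra R X →ₐ[R] A) (hp : Function.Surjective p) (S : Submodule R A)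
    (h1 : (1 : A) ∈ S) (hm : ∀ x, ∀ s ∈ S, s * p (FreeAlgebra.ι R x) ∈ S) (a : A) : a ∈ S := by
  obtain ⟨a, rfl⟩ := hp a
  suffices h : ∀ s ∈ S, s * p a ∈ S by simpa using h 1 h1
  induction a using FreeAlgebra.induction with
  | grade0 c =>
    intro s hs
    rw [AlgHom.commutes, ← Algebra.commutes, ← Algebra.smul_def]
    exact S.smul_mem _ hs
  | grade1 x => exact hm x
  | mul a b ha hb =>
    intro s hs
    rw [map_mul, ← mul_assoc]
    exact hb _ (ha _ hs)
  | add a b ha hb =>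
    intro s hs
    rw [map_add, mul_add]
    exact S.add_mem (ha _ hs) (hb _ hs)

lemma gen_left_induction {R X A : Type} [CommRing R] [Ring A] [Algebra R A]
    (p : FreeAlgebra R X →ₐ[R] A) (hp : Function.Surjective p) (S : Submodule R A)
    (h1 : (1 : A) ∈ S) (hm : ∀ x, ∀ s ∈ S, p (FreeAlgebra.ι R x) * s ∈ S) (a : A) : a ∈ S := by
  obtain ⟨a, rfl⟩ := hp a
  suffices h : ∀ s ∈ S, p a * s ∈ S by simpa using h 1 h1
  induction a using FreeAlgebra.induction with
  | grade0 c =>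
    intro s hs
    rw [AlgHom.commutes, ← Algebra.smul_def]
    exact S.smul_mem _ hs
  | grade1 x => exact hm x
  | mul a b ha hb =>
    intro s hs
    rw [map_mul, mul_assoc]
    exact ha _ (hb _ hs)
  | add a b ha hb =>
    intro s hs
    rw [map_add, add_mul]
    exact S.add_mem (ha _ hs) (hb _ hs)

/-! ### The Clifford algebra -/

inductive ClRel (R : Type) [CommRing R] (r : ℕ) :
    FreeAlgebra R (Fin r) → FreeAlgebra R (Fin r) → Prop
  | sq (j : Fin r) : ClRel R r (FreeAlgebra.ι R j * FreeAlgebra.ι R j) (-1)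
  | anti (i j : Fin r) (h : i ≠ j) :
      ClRel R r (FreeAlgebra.ι R i * FreeAlgebra.ι R j)
        (-(FreeAlgebra.ι R j * FreeAlgebra.ι R i))

abbrev Cl (R : Type) [CommRing R] (r : ℕ) := RingQuot (ClRel R r)

variable {R : Type} [CommRing R] {q : R} {r : ℕ}

def cg (R : Type) [CommRing R] {r : ℕ} (j : Fin r) : Cl R r :=
  RingQuot.mkAlgHom R (ClRel R r) (FreeAlgebra.ι R j)

lemma cg_sq (j : Fin r) : cg R j * cg R j = -1 := by
  have := RingQuot.mkAlgHom_rel R (ClRel.sq (R := R) j)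
  simpa [cg] using this

lemma cg_anti (i j : Fin r) (h : i ≠ j) : cg R i * cg R j = -(cg R j * cg R i) := by
  have := RingQuot.mkAlgHom_rel R (ClRel.anti (R := R) i j h)
  simpa [cg] using this

def clLift {A : Type} [Ring A] [Algebra R A] (g : Fin r → A) (h1 : ∀ j, g j * g j = -1)
    (h2 : ∀ i j, i ≠ j → g i * g j = -(g j * g i)) : Cl R r →ₐ[R] A :=
  RingQuot.liftAlgHom R ⟨FreeAlgebra.lift R g, by
    intro x y h
    cases h with
    | sq j => simp [h1]
    | anti i j h => simpa using h2 i j h⟩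

lemma clLift_cg {A : Type} [Ring A] [Algebra R A] (g : Fin r → A) (h1 : ∀ j, g j * g j = -1)
    (h2 : ∀ i j, i ≠ j → g i * g j = -(g j * g i)) (j : Fin r) :
    clLift (R := R) g h1 h2 (cg R j) = g j := by
  simp [clLift, cg]

lemma cl_induction (S : Submodule R (Cl R r)) (h1 : (1 : Cl R r) ∈ S)
    (hm : ∀ j, ∀ s ∈ S, cg R j * s ∈ S) (a : Cl R r) : a ∈ S :=
  gen_left_induction (RingQuot.mkAlgHom R (ClRel R r)) (RingQuot.mkAlgHom_surjective R _) S h1 hm a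

/-! ### Relations of `HC` -/

lemma TT_quad (k : Fin (r - 1)) :
    TT R q r k * TT R q r k = q • 1 + (q - 1) • TT R q r k := by
  have := RingQuot.mkAlgHom_rel R (HCRel.quad (R := R) (q := q) k)
  simp only [map_mul, map_sub, map_add, map_one, map_zero, AlgHom.commutes] at this
  change (TT R q r k - algebraMap R _ q) * (TT R q r k + 1) = 0 at this
  rw [sub_mul, mul_add, mul_one, ← Algebra.smul_def, smul_add, sub_eq_zero] at this
  rw [eq_sub_of_add_eq this]
  module

lemma CC_sq (j : Fin r) : CC R q r j * CC R q r j = -1 := by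
  have := RingQuot.mkAlgHom_rel R (HCRel.csq (R := R) (q := q) j)
  simpa [CC] using this

lemma CC_anti (i j : Fin r) (h : i ≠ j) : CC R q r i * CC R q r j = -(CC R q r j * CC R q r i) := by
  have := RingQuot.mkAlgHom_rel R (HCRel.canti (R := R) (q := q) i j h)
  simpa [CC] using this

lemma TC_comm (i : Fin (r - 1)) (j : Fin r) (h1 : j.val ≠ i.val) (h2 : j.val ≠ i.val + 1) :
    TT R q r i * CC R q r j = CC R q r j * TT R q r i := by
  have := RingQuot.mkAlgHom_rel R (HCRel.commTC (R := R) (q := q) i j h1 h2)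
  simpa [CC, TT] using this

lemma TC_lo (i : Fin (r - 1)) :
    TT R q r i * CC R q r (loIdx i) = CC R q r (hiIdx i) * TT R q r i := by
  have := RingQuot.mkAlgHom_rel R (HCRel.TClo (R := R) (q := q) i)
  simpa [CC, TT] using this

lemma TC_hi (i : Fin (r - 1)) :
    TT R q r i * CC R q r (hiIdx i) = CC R q r (loIdx i) * TT R q r i -
      (q - 1) • (CC R q r (loIdx i) - CC R q r (hiIdx i)) := by
  have := RingQuot.mkAlgHom_rel R (HCRel.TChi (R := R) (q := q) i)
  rw [Algebra.smul_def]
  simp only [map_mul, map_sub (RingQuot.mkAlgHom R (HCRel R q r)), AlgHom.commutes] at this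
  exact this

lemma hc_induction (S : Submodule R (HC R q r)) (h1 : (1 : HC R q r) ∈ S)
    (hT : ∀ k, ∀ s ∈ S, s * TT R q r k ∈ S) (hC : ∀ j, ∀ s ∈ S, s * CC R q r j ∈ S)
    (a : HC R q r) : a ∈ S :=
  gen_right_induction (RingQuot.mkAlgHom R (HCRel R q r)) (RingQuot.mkAlgHom_surjective R _) S h1
    (by rintro (k | j); exacts [hT k, hC j]) a

def hcLift {A : Type} [Ring A] [Algebra R A] (t : Fin (r - 1) → A) (c : Fin r → A)
    (h1 : ∀ j, c j * c j = -1)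
    (h2 : ∀ i j, i ≠ j → c i * c j = -(c j * c i))
    (h3 : ∀ i, t i * t i = q • 1 + (q - 1) • t i)
    (h4 : ∀ i i' : Fin (r - 1), i.val + 1 < i'.val → t i * t i' = t i' * t i)
    (h5 : ∀ i i' : Fin (r - 1), i'.val = i.val + 1 → t i * t i' * t i = t i' * t i * t i')
    (h6 : ∀ (i : Fin (r - 1)) (j : Fin r), j.val ≠ i.val → j.val ≠ i.val + 1 →
      t i * c j = c j * t i)
    (h7 : ∀ i, t i * c (loIdx i) = c (hiIdx i) * t i)
    (h8 : ∀ i, t i * c (hiIdx i) = c (loIdx i) * t i - (q - 1) • (c (loIdx i) - c (hiIdx i))) :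
    HC R q r →ₐ[R] A :=
  RingQuot.liftAlgHom R ⟨FreeAlgebra.lift R (Sum.elim t c), by
    intro x y h
    cases h with
    | csq j => simp [h1, Cf]
    | canti i j h => simpa [Cf] using h2 i j h
    | quad i =>
      simp only [Tf, map_mul, map_sub, map_add, map_one, map_zero, AlgHom.commutes,
        FreeAlgebra.lift_ι_apply, Sum.elim_inl]
      rw [sub_mul, mul_add, mul_one, ← Algebra.smul_def, h3]
      module
    | commTT i i' h => simpa [Tf] using h4 i i' h
    | braid i i' h => simpa [Tf] using h5 i i' h
    | commTC i j a b => simpa [Tf, Cf] using h6 i j a b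
    | TClo i => simpa [Tf, Cf] using h7 i
    | TChi i =>
      simp only [Tf, Cf, map_mul, map_sub, AlgHom.commutes,
        FreeAlgebra.lift_ι_apply, Sum.elim_inl, Sum.elim_inr]
      rw [h8, Algebra.smul_def, map_sub]⟩

/-! ### The twisted derivations -/

/-- The twisted derivation on generators. -/
def mOff (q : R) (i : Fin (r - 1)) (k : Fin r) : Cl R r :=
  if k = hiIdx i then -((q - 1) • (cg R (loIdx i) - cg R (hiIdx i))) else 0

/-- Image of a generator in two by two matrices. -/
def mgen (q : R) (i : Fin (r - 1)) (k : Fin r) : Matrix (Fin 2) (Fin 2) (Cl R r) :=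
  !![cg R (simpleT i k), mOff q i k; 0, cg R k]

lemma lo_ne_hi (i : Fin (r - 1)) : loIdx i ≠ hiIdx i := by
  simp [loIdx, hiIdx]

lemma simpleT_lo (i : Fin (r - 1)) : simpleT i (loIdx i) = hiIdx i := Equiv.swap_apply_left _ _

lemma simpleT_hi (i : Fin (r - 1)) : simpleT i (hiIdx i) = loIdx i := Equiv.swap_apply_right _ _

lemma simpleT_ne (i : Fin (r - 1)) {k : Fin r} (h1 : k ≠ loIdx i) (h2 : k ≠ hiIdx i) :
    simpleT i k = k := Equiv.swap_apply_of_ne_of_ne h1 h2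

section aux
variable {A : Type} [Ring A] [Algebra R A]

lemma ring_aux1 (e : R) (a b : A) (ha : a * a = -1) (hb : b * b = -1) :
    a * -(e • (a - b)) + -(e • (a - b)) * b = 0 := by
  simp only [mul_neg, neg_mul, mul_smul_comm, smul_mul_assoc, mul_sub, sub_mul, ha, hb]
  module

lemma ring_aux2 (e : R) (a b : A) (ha : a * a = -1) (hb : b * b = -1) :
    -(e • (a - b)) * a = -(b * -(e • (a - b))) := by
  simp only [mul_neg, neg_mul, mul_smul_comm, smul_mul_assoc, mul_sub, sub_mul, ha, hb]
  module

lemma ring_aux3 (e : R) (a b c : A) (ha : c * a = -(a * c)) (hb : c * b = -(b * c)) :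
    -(e • (a - b)) * c = -(c * -(e • (a - b))) := by
  simp only [mul_neg, neg_mul, mul_smul_comm, smul_mul_assoc, mul_sub, sub_mul, ha, hb]
  module

end aux

lemma mgen_sq (i : Fin (r - 1)) (k : Fin r) : mgen q i k * mgen q i k = -1 := by
  ext a b
  fin_cases a <;> fin_cases b <;> simp [mgen, Matrix.mul_apply, Fin.sum_univ_two, cg_sq]
  unfold mOff
  split_ifs with h
  · subst h
    rw [simpleT_hi]
    exact ring_aux1 _ _ _ (cg_sq _) (cg_sq _)
  · simp

lemma mgen_anti (i : Fin (r - 1)) (k l : Fin r) (hkl : k ≠ l) :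
    mgen q i k * mgen q i l = -(mgen q i l * mgen q i k) := by
  ext a b
  fin_cases a <;> fin_cases b <;>
    simp [mgen, Matrix.mul_apply, Fin.sum_univ_two]
  · exact cg_anti (R := R) _ _ (by simpa using hkl)
  · have main : ∀ k l : Fin r, k ≠ l → k = hiIdx i →
        -((q - 1) • (cg R (loIdx i) - cg R (hiIdx i))) * cg R l =
        -(cg R (simpleT i l) * -((q - 1) • (cg R (loIdx i) - cg R (hiIdx i)))) := by
      intro k l hkl h
      subst h
      by_cases hl : l = loIdx i
      · subst hl
        rw [simpleT_lo]
        exact ring_aux2 _ _ _ (cg_sq _) (cg_sq _)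
      · rw [simpleT_ne i hl hkl.symm]
        exact ring_aux3 _ _ _ _ (cg_anti (R := R) l (loIdx i) hl)
          (cg_anti (R := R) l (hiIdx i) hkl.symm)
    unfold mOff
    by_cases hk : k = hiIdx i
    · have hl : l ≠ hiIdx i := fun h => hkl (hk.trans h.symm)
      rw [if_pos hk, if_neg hl, main k l hkl hk]
      simp
    · by_cases hl : l = hiIdx i
      · rw [if_pos hl, if_neg hk, main l k hkl.symm hl]
        simp
      · rw [if_neg hl, if_neg hk]
        simp
  · exact cg_anti (R := R) _ _ hkl

def mhom (q : R) (i : Fin (r - 1)) : Cl R r →ₐ[R] Matrix (Fin 2) (Fin 2) (Cl R r) :=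
  clLift (mgen q i) (mgen_sq i) (mgen_anti i)

def sg (q : R) (i : Fin (r - 1)) : Cl R r →ₗ[R] Cl R r :=
  (Matrix.entryLinearMap R (Cl R r) 0 0).comp (mhom q i).toLinearMap

def dl (q : R) (i : Fin (r - 1)) : Cl R r →ₗ[R] Cl R r :=
  (Matrix.entryLinearMap R (Cl R r) 0 1).comp (mhom q i).toLinearMap

lemma mhom_10 (i : Fin (r - 1)) (c : Cl R r) : mhom q i c 1 0 = 0 ∧ mhom q i c 1 1 = c := by
  let S : Submodule R (Cl R r) :=
    LinearMap.ker ((Matrix.entryLinearMap R (Cl R r) 1 0).comp (mhom q i).toLinearMap) ⊓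
    LinearMap.ker ((Matrix.entryLinearMap R (Cl R r) 1 1).comp (mhom q i).toLinearMap
      - LinearMap.id)
  have hS : ∀ c, c ∈ S ↔ (mhom q i c 1 0 = 0 ∧ mhom q i c 1 1 = c) := by
    intro c
    simp [S, sub_eq_zero]
  rw [← hS]
  apply cl_induction
  · rw [hS]; simp
  · intro j s hs
    rw [hS] at hs ⊢
    rw [map_mul]
    simp [Matrix.mul_apply, Fin.sum_univ_two, mhom, clLift_cg, mgen]
    exact ⟨by simpa [mhom] using congrArg (cg R j * ·) hs.1,
      by simpa [mhom] using congrArg (cg R j * ·) hs.2⟩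

lemma sg_cg_mul (i : Fin (r - 1)) (k : Fin r) (c : Cl R r) :
    sg q i (cg R k * c) = cg R (simpleT i k) * sg q i c := by
  have h := mhom_10 (q := q) i c
  simp only [sg, LinearMap.comp_apply, AlgHom.toLinearMap_apply, Matrix.entryLinearMap_apply,
    map_mul, Matrix.mul_apply, Fin.sum_univ_two, h.1]
  simp [mhom, clLift_cg, mgen]

lemma dl_cg_mul (i : Fin (r - 1)) (k : Fin r) (c : Cl R r) :
    dl q i (cg R k * c) = cg R (simpleT i k) * dl q i c +
     mOff q i k * c := by
  have h := mhom_10 (q := q) i c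
  simp only [dl, LinearMap.comp_apply, AlgHom.toLinearMap_apply, Matrix.entryLinearMap_apply,
    map_mul, Matrix.mul_apply, Fin.sum_univ_two, h.2]
  simp only [mhom, clLift_cg, mgen]
  simp

lemma sg_one (i : Fin (r - 1)) : sg q i (1 : Cl R r) = 1 := by
  simp [sg]

lemma dl_one (i : Fin (r - 1)) : dl q i (1 : Cl R r) = 0 := by
  simp [dl]

/-! ### The representation -/

abbrev VV (R : Type) [CommRing R] (r : ℕ) := Equiv.Perm (Fin r) → Cl R r

def tOp (q : R) (i : Fin (r - 1)) : VV R r →ₗ[R] VV R r where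
  toFun f w := (if w⁻¹ (loIdx i) < w⁻¹ (hiIdx i) then q • sg q i (f (simpleT i * w))
    else sg q i (f (simpleT i * w)) + (q - 1) • sg q i (f w)) + dl q i (f w)
  map_add' f g := by
    ext w
    simp only [Pi.add_apply, map_add]
    split_ifs <;> module
  map_smul' a f := by
    ext w
    simp only [Pi.smul_apply, map_smul, RingHom.id_apply]
    split_ifs <;> module

lemma tOp_apply (i : Fin (r - 1)) (f : VV R r) (w : Equiv.Perm (Fin r)) :
    tOp q i f w = (if w⁻¹ (loIdx i) < w⁻¹ (hiIdx i) then q • sg q i (f (simpleT i * w))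
    else sg q i (f (simpleT i * w)) + (q - 1) • sg q i (f w)) + dl q i (f w) := rfl

def cOp (k : Fin r) : VV R r →ₗ[R] VV R r := Algebra.lsmul R R (VV R r) (cg R k)

lemma cOp_apply (k : Fin r) (f : VV R r) (w : Equiv.Perm (Fin r)) :
    cOp k f w = cg R k * f w := rfl

lemma tOp_cOp (i : Fin (r - 1)) (k : Fin r) (f : VV R r) :
    tOp q i (cOp k f) = cOp (simpleT i k) (tOp q i f) +
      if k = hiIdx i then -((q - 1) • (cOp (loIdx i) f - cOp (hiIdx i) f)) else 0 := by
  ext w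
  rw [Pi.add_apply]
  simp only [tOp_apply, cOp_apply, sg_cg_mul, dl_cg_mul, mOff]
  split_ifs <;> simp [mul_add, cOp_apply, sub_mul, smul_sub] <;> module

def baseV (g : Equiv.Perm (Fin r) → R) : VV R r := fun w => g w • 1

def tB (q : R) (i : Fin (r - 1)) (g : Equiv.Perm (Fin r) → R) : Equiv.Perm (Fin r) → R := fun w =>
  if w⁻¹ (loIdx i) < w⁻¹ (hiIdx i) then q * g (simpleT i * w)
    else g (simpleT i * w) + (q - 1) * g w

lemma tOp_base (i : Fin (r - 1)) (g : Equiv.Perm (Fin r) → R) :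
    tOp q i (baseV g) = baseV (tB q i g) := by
  ext w
  simp only [tOp_apply, baseV, map_smul, sg_one, dl_one, tB]
  split_ifs <;> module

lemma kill (E : VV R r →ₗ[R] VV R r) (p : Fin r → Fin r)
    (h : ∀ k f, E (cOp k f) = cOp (p k) (E f)) (hb : ∀ g, E (baseV g) = 0) : E = 0 := by
  have h1 : ∀ (c : Cl R r) (g : Equiv.Perm (Fin r) → R), E (c • baseV g) = 0 := by
    intro c g
    let S : Submodule R (Cl R r) := LinearMap.ker (E.comp (LinearMap.toSpanSingleton (Cl R r)
      (VV R r) (baseV g) |>.restrictScalars R))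
    have hS : ∀ c, c ∈ S ↔ E (c • baseV g) = 0 := by intro c; simp [S]
    rw [← hS]
    apply cl_induction
    · rw [hS, one_smul, hb]
    · intro j s hs
      rw [hS] at hs ⊢
      have : (cg R j * s) • baseV g = cOp j (s • baseV g) := by
        rw [mul_smul]; rfl
      rw [this, h, hs, map_zero]
  refine LinearMap.ext fun f => ?_
  have : f = ∑ w : Equiv.Perm (Fin r), f w • baseV (Pi.single w 1) := by
    ext v
    simp [baseV, Finset.sum_apply, Pi.single_apply]
  rw [this, map_sum]
  simp [h1]

lemma tB_quad (i : Fin (r - 1)) (g : Equiv.Perm (Fin r) → R) (w : Equiv.Perm (Fin r)) :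
    tB q i (tB q i g) w = q * g w + (q - 1) * tB q i g w := by
  have hss : ∀ w, simpleT i * (simpleT i * w) = w := by
    intro w; simp [simpleT]
  have hne : w⁻¹ (loIdx i) ≠ w⁻¹ (hiIdx i) := by simp [lo_ne_hi]
  have hinv : (simpleT i)⁻¹ = simpleT i := by simp [simpleT]
  simp only [tB, mul_inv_rev, Equiv.Perm.mul_apply, hinv, simpleT_lo, simpleT_hi, hss]
  rcases lt_or_gt_of_ne hne with h | h
  · simp only [h, h.not_gt, if_true, if_false]; ring
  · simp only [h, h.not_gt, if_true, if_false]

lemma simpleT_inv (i : Fin (r - 1)) : (simpleT i)⁻¹ = simpleT i := by simp [simpleT]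

lemma simpleT_mul_self (i : Fin (r - 1)) : simpleT i * simpleT i = 1 := by simp [simpleT]

lemma tB_comm (i j : Fin (r - 1)) (hij : i.val + 1 < j.val) (g : Equiv.Perm (Fin r) → R)
    (w : Equiv.Perm (Fin r)) :
    tB q i (tB q j g) w = tB q j (tB q i g) w := by
  have e1 : simpleT i (loIdx j) = loIdx j :=
    simpleT_ne _ (by simp [loIdx]; omega) (by simp [loIdx, hiIdx]; omega)
  have e2 : simpleT i (hiIdx j) = hiIdx j :=
    simpleT_ne _ (by simp [loIdx, hiIdx]; omega) (by simp [hiIdx]; omega)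
  have e3 : simpleT j (loIdx i) = loIdx i :=
    simpleT_ne _ (by simp [loIdx]; omega) (by simp [loIdx, hiIdx]; omega)
  have e4 : simpleT j (hiIdx i) = hiIdx i :=
    simpleT_ne _ (by simp [loIdx, hiIdx]; omega) (by simp [hiIdx]; omega)
  have hc : simpleT j * (simpleT i * w) = simpleT i * (simpleT j * w) := by
    rw [← mul_assoc, ← mul_assoc]
    congr 1
    ext x
    simp only [Equiv.Perm.mul_apply]
    congr 1
    by_cases h1 : x = loIdx i
    · subst h1; rw [simpleT_lo, e3, simpleT_lo, e4]
    by_cases h2 : x = hiIdx i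
    · subst h2; rw [simpleT_hi, e4, simpleT_hi, e3]
    rw [simpleT_ne i h1 h2]
    by_cases h3 : x = loIdx j
    · subst h3; rw [simpleT_lo, e2]
    by_cases h4 : x = hiIdx j
    · subst h4; rw [simpleT_hi, e1]
    rw [simpleT_ne j h3 h4, simpleT_ne i h1 h2]
  simp only [tB, mul_inv_rev, Equiv.Perm.mul_apply, simpleT_inv, e1, e2, e3, e4, hc]
  split_ifs <;> ring

lemma hi_eq_lo (i j : Fin (r - 1)) (hij : j.val = i.val + 1) : hiIdx i = loIdx j := by
  simp [hiIdx, loIdx, hij]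

lemma braid_vals (i j : Fin (r - 1)) (hij : j.val = i.val + 1) :
    simpleT i (loIdx j) = loIdx i ∧ simpleT i (loIdx i) = loIdx j ∧
    simpleT i (hiIdx j) = hiIdx j ∧ simpleT j (loIdx i) = loIdx i ∧
    simpleT j (loIdx j) = hiIdx j ∧ simpleT j (hiIdx j) = loIdx j := by
  have h := hi_eq_lo i j hij
  refine ⟨by rw [← h, simpleT_hi], by rw [← h, simpleT_lo], ?_, ?_, simpleT_lo j, simpleT_hi j⟩
  · exact simpleT_ne _ (by simp [loIdx, hiIdx]; omega) (by simp [hiIdx]; omega)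
  · exact simpleT_ne _ (by simp [loIdx]; omega) (by simp [loIdx, hiIdx]; omega)

lemma tB_braid (i j : Fin (r - 1)) (hij : j.val = i.val + 1) (g : Equiv.Perm (Fin r) → R)
    (w : Equiv.Perm (Fin r)) :
    tB q i (tB q j (tB q i g)) w = tB q j (tB q i (tB q j g)) w := by
  obtain ⟨e1, e2, e3, e4, e5, e6⟩ := braid_vals i j hij
  have h := hi_eq_lo i j hij
  have ii : ∀ w, simpleT i * (simpleT i * w) = w := by intro w; simp [simpleT]
  have jj : ∀ w, simpleT j * (simpleT j * w) = w := by intro w; simp [simpleT]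
  have br : simpleT i * (simpleT j * (simpleT i * w)) = simpleT j * (simpleT i * (simpleT j * w)) := by
    simp only [← mul_assoc]
    congr 1
    ext x
    simp only [Equiv.Perm.mul_apply]
    congr 1
    by_cases h1 : x = loIdx i
    · subst h1; simp only [e1, e2, e3, e4, e5, e6]
    by_cases h2 : x = loIdx j
    · subst h2; simp only [e1, e2, e3, e4, e5, e6]
    by_cases h3 : x = hiIdx j
    · subst h3; simp only [e1, e2, e3, e4, e5, e6]
    have a1 : simpleT i x = x := simpleT_ne i h1 (h ▸ h2)
    have a2 : simpleT j x = x := simpleT_ne j h2 h3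
    simp only [a1, a2]
  have n1 : w⁻¹ (loIdx i) ≠ w⁻¹ (loIdx j) := by simp [loIdx]; omega
  have n2 : w⁻¹ (loIdx i) ≠ w⁻¹ (hiIdx j) := by simp [loIdx, hiIdx]; omega
  have n3 : w⁻¹ (loIdx j) ≠ w⁻¹ (hiIdx j) := by simp [loIdx, hiIdx]
  simp only [tB, mul_inv_rev, Equiv.Perm.mul_apply, simpleT_inv, h, e1, e2, e3, e4, e5, e6, br,
    ii, jj]
  generalize w⁻¹ (loIdx i) = a at *
  generalize w⁻¹ (loIdx j) = b at *
  generalize w⁻¹ (hiIdx j) = c at *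
  rcases lt_or_gt_of_ne n1 with h1 | h1 <;> rcases lt_or_gt_of_ne n2 with h2 | h2 <;>
    rcases lt_or_gt_of_ne n3 with h3 | h3 <;>
    first
    | (exfalso; order)
    | (simp only [h1, h2, h3, h1.not_gt, h2.not_gt, h3.not_gt, if_true, if_false]; try ring)

end
end HCPaper

namespace HCPaper

noncomputable section

section aux
variable {R : Type} [CommRing R] {A : Type} [Ring A] [Algebra R A]

lemma assoc_rule {t a b : A} (h : t * a = b) (x : A) : t * (a * x) = b * x := by
  rw [← mul_assoc, h]

lemma quad_aux (e : R) (t a b : A) (h1 : t * a = b * t) (h2 : t * b = a * t - e • (a - b)) :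
    (t * t - ((e + 1) • 1 + e • t)) * a = a * (t * t - ((e + 1) • 1 + e • t)) ∧
    (t * t - ((e + 1) • 1 + e • t)) * b = b * (t * t - ((e + 1) • 1 + e • t)) := by
  have h1' := assoc_rule h1
  have h2' := assoc_rule h2
  constructor
  all_goals
    simp only [mul_add, add_mul, mul_sub, sub_mul, mul_assoc, smul_mul_assoc, mul_smul_comm, h1, h2,
      h1', h2', one_mul, mul_one, smul_sub, smul_add]
    module

lemma quad_aux' (e : R) (t a : A) (h1 : t * a = a * t) :
    (t * t - ((e + 1) • 1 + e • t)) * a = a * (t * t - ((e + 1) • 1 + e • t)) := by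
  have h1' := assoc_rule h1
  simp only [mul_add, add_mul, mul_sub, sub_mul, mul_assoc, smul_mul_assoc, mul_smul_comm, h1,
      h1', one_mul, mul_one]

lemma comm_aux (e : R) (t s a b : A) (h1 : t * a = b * t) (h2 : t * b = a * t - e • (a - b))
    (h3 : s * a = a * s) (h4 : s * b = b * s) :
    (t * s - s * t) * a = b * (t * s - s * t) ∧ (t * s - s * t) * b = a * (t * s - s * t) := by
  have h1' := assoc_rule h1
  have h2' := assoc_rule h2
  have h3' := assoc_rule h3
  have h4' := assoc_rule h4
  constructor
  all_goals
    simp only [mul_add, add_mul, mul_sub, sub_mul, mul_assoc, smul_mul_assoc, mul_smul_comm, h1, h2,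
      h1', h2', h3, h3', h4, h4', one_mul, mul_one, smul_sub, smul_add]
  module

lemma comm_aux2 (e : R) (t s a b : A) (h1 : t * a = b * t) (h2 : t * b = a * t - e • (a - b))
    (h3 : s * a = a * s) (h4 : s * b = b * s) :
    (s * t - t * s) * a = b * (s * t - t * s) ∧ (s * t - t * s) * b = a * (s * t - t * s) := by
  have h := comm_aux e t s a b h1 h2 h3 h4
  have en : t * s - s * t = -(s * t - t * s) := (neg_sub _ _).symm
  rw [en] at h
  simpa only [neg_mul, mul_neg, neg_inj] using h

lemma comm_aux' (t s a : A) (h1 : t * a = a * t) (h3 : s * a = a * s) :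
    (t * s - s * t) * a = a * (t * s - s * t) := by
  have h1' := assoc_rule h1
  have h3' := assoc_rule h3
  simp only [mul_sub, sub_mul, mul_assoc, h1, h1', h3, h3']

lemma braid_aux (e : R) (t s a b c : A) (h1 : t * a = b * t) (h2 : t * b = a * t - e • (a - b))
    (h3 : t * c = c * t)
    (g1 : s * b = c * s) (g2 : s * c = b * s - e • (b - c)) (g3 : s * a = a * s)
    (ht : t * t = (e + 1) • 1 + e • t) (hs : s * s = (e + 1) • 1 + e • s) :
    (t * s * t - s * t * s) * a = c * (t * s * t - s * t * s) ∧
    (t * s * t - s * t * s) * b = b * (t * s * t - s * t * s) ∧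
    (t * s * t - s * t * s) * c = a * (t * s * t - s * t * s) := by
  have h1' := assoc_rule h1
  have h2' := assoc_rule h2
  have h3' := assoc_rule h3
  have g1' := assoc_rule g1
  have g2' := assoc_rule g2
  have g3' := assoc_rule g3
  refine ⟨?_, ?_, ?_⟩
  all_goals
    simp only [mul_add, add_mul, mul_sub, sub_mul, mul_assoc, smul_mul_assoc, mul_smul_comm, h1, h2,
      h1', h2', h3, h3', g1, g1', g2, g2', g3, g3', one_mul, mul_one, smul_sub, smul_add, ht, hs]
  all_goals module

lemma braid_aux' (t s a : A) (h1 : t * a = a * t) (h3 : s * a = a * s) :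
    (t * s * t - s * t * s) * a = a * (t * s * t - s * t * s) := by
  have h1' := assoc_rule h1
  have h3' := assoc_rule h3
  simp only [mul_sub, sub_mul, mul_assoc, h1, h1', h3, h3']

end aux

variable {R : Type} [CommRing R] {q : R} {r : ℕ}

abbrev tE (q : R) (i : Fin (r - 1)) : Module.End R (VV R r) := tOp q i
abbrev cE (R : Type) [CommRing R] {r : ℕ} (k : Fin r) : Module.End R (VV R r) := cOp k

lemma tE_lo (i : Fin (r - 1)) : tE q i * cE R (loIdx i) = cE R (hiIdx i) * tE q i := by
  refine LinearMap.ext fun f => ?_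
  simp only [Module.End.mul_apply, tOp_cOp, lo_ne_hi, simpleT_lo, if_false, add_zero]

lemma tE_hi (i : Fin (r - 1)) : tE q i * cE R (hiIdx i) = cE R (loIdx i) * tE q i -
    (q - 1) • (cE R (loIdx i) - cE R (hiIdx i)) := by
  refine LinearMap.ext fun f => ?_
  simp only [Module.End.mul_apply, tOp_cOp, simpleT_hi, if_true, LinearMap.sub_apply,
    LinearMap.smul_apply]
  exact (sub_eq_add_neg _ _).symm

lemma tE_ne (i : Fin (r - 1)) (k : Fin r) (h1 : k ≠ loIdx i) (h2 : k ≠ hiIdx i) :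
    tE q i * cE R k = cE R k * tE q i := by
  refine LinearMap.ext fun f => ?_
  simp only [Module.End.mul_apply, tOp_cOp, simpleT_ne i h1 h2, h2, if_false, add_zero]

lemma killE (E : Module.End R (VV R r)) (h : ∀ k, ∃ k', E * cE R k = cE R k' * E)
    (hb : ∀ g, E (baseV g) = 0) : E = 0 := by
  choose p hp using h
  exact kill E p (fun k f => by simpa using LinearMap.congr_fun (hp k) f) hb

lemma tE_quad (i : Fin (r - 1)) : tE q i * tE q i = q • 1 + (q - 1) • tE q i := by
  rw [← sub_eq_zero]
  have e : q = (q - 1) + 1 := by ring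
  have e' : tE q i * tE q i - (q • 1 + (q - 1) • tE q i) =
      tE q i * tE q i - (((q - 1) + 1) • 1 + (q - 1) • tE q i) := by rw [← e]
  apply killE
  · intro k
    refine ⟨k, ?_⟩
    rw [e']
    by_cases h1 : k = loIdx i
    · subst h1; exact (quad_aux (q - 1) (tE q i) _ _ (tE_lo i) (tE_hi i)).1
    by_cases h2 : k = hiIdx i
    · subst h2; exact (quad_aux (q - 1) (tE q i) _ _ (tE_lo i) (tE_hi i)).2
    exact quad_aux' (q - 1) (tE q i) _ (tE_ne i k h1 h2)
  · intro g
    simp only [LinearMap.sub_apply, LinearMap.add_apply, LinearMap.smul_apply, Module.End.mul_apply,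
      Module.End.one_apply, tOp_base]
    ext w
    simp only [Pi.sub_apply, Pi.add_apply, Pi.smul_apply, baseV, tB_quad]
    rw [Pi.zero_apply]
    module

lemma tE_comm (i j : Fin (r - 1)) (hij : i.val + 1 < j.val) :
    tE q i * tE q j = tE q j * tE q i := by
  rw [← sub_eq_zero]
  have n1 : loIdx i ≠ loIdx j := by simp [loIdx]; omega
  have n2 : loIdx i ≠ hiIdx j := by simp [loIdx, hiIdx]; omega
  have n3 : hiIdx i ≠ loIdx j := by simp [loIdx, hiIdx]; omega
  have n4 : hiIdx i ≠ hiIdx j := by simp [hiIdx]; omega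
  have A1 := comm_aux (q - 1) (tE q i) (tE q j) _ _ (tE_lo i) (tE_hi i)
    (tE_ne j _ n1 n2) (tE_ne j _ n3 n4)
  have A2 := comm_aux2 (q - 1) (tE q j) (tE q i) _ _ (tE_lo j) (tE_hi j)
    (tE_ne i _ n1.symm n3.symm) (tE_ne i _ n2.symm n4.symm)
  apply killE
  · intro k
    by_cases h1 : k = loIdx i
    · subst h1; exact ⟨_, A1.1⟩
    by_cases h2 : k = hiIdx i
    · subst h2; exact ⟨_, A1.2⟩
    by_cases h3 : k = loIdx j
    · subst h3; exact ⟨_, A2.1⟩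
    by_cases h4 : k = hiIdx j
    · subst h4; exact ⟨_, A2.2⟩
    exact ⟨k, comm_aux' (tE q i) (tE q j) (cE R k) (tE_ne i k h1 h2) (tE_ne j k h3 h4)⟩
  · intro g
    simp only [LinearMap.sub_apply, Module.End.mul_apply, tOp_base]
    rw [sub_eq_zero]
    congr 1
    ext w
    exact tB_comm i j hij g w

lemma tE_braid (i j : Fin (r - 1)) (hij : j.val = i.val + 1) :
    tE q i * tE q j * tE q i = tE q j * tE q i * tE q j := by
  rw [← sub_eq_zero]
  have h := hi_eq_lo i j hij
  have n1 : loIdx i ≠ loIdx j := by simp [loIdx]; omega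
  have n2 : loIdx i ≠ hiIdx j := by simp [loIdx, hiIdx]; omega
  have n4 : hiIdx i ≠ hiIdx j := by simp [hiIdx]; omega
  have A1 := braid_aux (q - 1) (tE q i) (tE q j) _ _ (cE R (hiIdx j)) (tE_lo i) (tE_hi i)
    (tE_ne i _ n2.symm n4.symm) (h ▸ tE_lo j) (h ▸ tE_hi j) (tE_ne j _ n1 n2)
    (by rw [sub_add_cancel]; exact tE_quad i) (by rw [sub_add_cancel]; exact tE_quad j)
  apply killE
  · intro k
    by_cases h1 : k = loIdx i
    · subst h1; exact ⟨_, A1.1⟩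
    by_cases h2 : k = hiIdx i
    · subst h2; exact ⟨_, A1.2.1⟩
    by_cases h3 : k = hiIdx j
    · subst h3; exact ⟨_, A1.2.2⟩
    exact ⟨k, braid_aux' (tE q i) (tE q j) (cE R k) (tE_ne i k h1 h2) (tE_ne j k (h ▸ h2) h3)⟩
  · intro g
    simp only [LinearMap.sub_apply, Module.End.mul_apply, tOp_base]
    rw [sub_eq_zero]
    congr 1
    ext w
    exact tB_braid i j hij g w

/-- The representation of `HC` on `VV`. -/
def rho (q : R) (r : ℕ) : HC R q r →ₐ[R] Module.End R (VV R r) :=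
  hcLift (tE q) (cE R)
    (by
      intro j
      change Algebra.lsmul R R (VV R r) (cg R j) * Algebra.lsmul R R (VV R r) (cg R j) = -1
      rw [← map_mul, cg_sq, map_neg, map_one])
    (by
      intro i j h
      change Algebra.lsmul R R (VV R r) (cg R i) * Algebra.lsmul R R (VV R r) (cg R j) =
        -(Algebra.lsmul R R (VV R r) (cg R j) * Algebra.lsmul R R (VV R r) (cg R i))
      rw [← map_mul, cg_anti _ _ h, map_neg, map_mul])
    tE_quad tE_comm tE_braid
    (fun i j h1 h2 => tE_ne i j (fun h => h1 (by rw [h]; rfl)) (fun h => h2 (by rw [h]; rfl)))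
    tE_lo tE_hi

lemma rho_TT (k : Fin (r - 1)) : rho q r (TT R q r k) = tE q k := by
  simp [rho, hcLift, TT, Tf]

lemma rho_CC (k : Fin r) : rho q r (CC R q r k) = cE R k := by
  simp [rho, hcLift, CC, Cf]

/-- The Clifford algebra maps to `HC`. -/
def io (q : R) (r : ℕ) : Cl R r →ₐ[R] HC R q r := clLift (CC R q r) CC_sq CC_anti

lemma io_cg (k : Fin r) : io q r (cg R k) = CC R q r k := clLift_cg _ _ _ _

lemma rho_io (c : Cl R r) (f : VV R r) : rho q r (io q r c) f = c • f := by
  let L : Cl R r →ₐ[R] Module.End R (VV R r) := Algebra.lsmul R R (VV R r)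
  let S : Submodule R (Cl R r) := LinearMap.eqLocus ((rho q r).comp (io q r)).toLinearMap
    L.toLinearMap
  have hS : ∀ c, c ∈ S ↔ rho q r (io q r c) = L c := by
    intro c; simp [S]
  suffices h : c ∈ S by rw [(hS c).1 h]; rfl
  apply cl_induction
  · rw [hS]; simp
  · intro j s hs
    rw [hS] at hs ⊢
    rw [map_mul, map_mul, hs, io_cg, rho_CC, map_mul]
    rfl

/-! ### Lengths -/

lemma simpleT_lt (k : Fin (r - 1)) {x y : Fin r} (h : x < y) (hne : ¬ (x = loIdx k ∧ y = hiIdx k)) :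
    simpleT k x < simpleT k y := by
  unfold simpleT
  rw [Equiv.swap_apply_def, Equiv.swap_apply_def]
  simp only [loIdx, hiIdx, Fin.ext_iff, Fin.lt_def] at *
  split_ifs <;> (try dsimp only at *) <;> omega

lemma len_up (w : Equiv.Perm (Fin r)) (k : Fin (r - 1)) (h : w (loIdx k) < w (hiIdx k)) :
    len (w * simpleT k) = len w + 1 := by
  have hss : ∀ x, simpleT k (simpleT k x) = x := fun x => by simp [simpleT]
  have lohi : loIdx k < hiIdx k := by simp [loIdx, hiIdx, Fin.lt_def]
  unfold len
  have key : (Finset.univ.filter fun p : Fin r × Fin r => p.1 < p.2 ∧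
      (w * simpleT k) p.2 < (w * simpleT k) p.1) =
      insert (loIdx k, hiIdx k) ((Finset.univ.filter fun p : Fin r × Fin r => p.1 < p.2 ∧
      w p.2 < w p.1).map ((simpleT k).prodCongr (simpleT k)).toEmbedding) := by
    ext ⟨x, y⟩
    rw [Finset.mem_filter]
    simp only [Finset.mem_filter, Finset.mem_univ, true_and, Equiv.Perm.mul_apply,
      Finset.mem_insert, Finset.mem_map, Prod.exists, Equiv.coe_toEmbedding, Equiv.prodCongr_apply,
      Prod.map_apply, Prod.mk.injEq]
    constructor
    · rintro ⟨h1, h2⟩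
      by_cases hc : x = loIdx k ∧ y = hiIdx k
      · exact Or.inl hc
      · exact Or.inr ⟨_, _, ⟨simpleT_lt k h1 hc, h2⟩, hss _, hss _⟩
    · rintro (⟨rfl, rfl⟩ | ⟨a, b, ⟨h1, h2⟩, rfl, rfl⟩)
      · rw [simpleT_lo, simpleT_hi]
        exact ⟨lohi, h⟩
      · rw [hss, hss]
        refine ⟨simpleT_lt k h1 ?_, h2⟩
        rintro ⟨rfl, rfl⟩
        exact absurd h2 h.not_gt
  rw [key, Finset.card_insert_of_notMem, Finset.card_map]
  simp only [Finset.mem_filter, Finset.mem_univ, true_and,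
      Finset.mem_map, Prod.exists, Equiv.coe_toEmbedding, Equiv.prodCongr_apply,
      Prod.map_apply, Prod.mk.injEq]
  rintro ⟨a, b, ⟨h1, h2⟩, h3, h4⟩
  have h3' := congrArg (simpleT k) h3
  have h4' := congrArg (simpleT k) h4
  rw [hss, simpleT_lo] at h3'
  rw [hss, simpleT_hi] at h4'
  subst h3' h4'
  exact absurd h1 lohi.not_gt

lemma mul_ss (w : Equiv.Perm (Fin r)) (k : Fin (r - 1)) : w * simpleT k * simpleT k = w := by
  rw [mul_assoc, simpleT_mul_self, mul_one]

lemma exists_descent (w : Equiv.Perm (Fin r)) (hw : w ≠ 1) :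
    ∃ k : Fin (r - 1), w (hiIdx k) < w (loIdx k) := by
  by_contra hcon
  push Not at hcon
  apply hw
  have hmono : StrictMono w := by
    cases r with
    | zero => intro x; exact x.elim0
    | succ m =>
      rw [Fin.strictMono_iff_lt_succ]
      intro i
      have := hcon ⟨i, by simp⟩
      refine lt_of_le_of_ne this ?_
      intro h
      have := w.injective h
      simp [Fin.ext_iff] at this
  ext x
  have : (hmono.orderIsoOfSurjective _ w.surjective) = OrderIso.refl _ := Subsingleton.elim _ _
  have := congrArg (fun e => e x) this
  simpa using congrArg Fin.val this

/-- Induction along right ascents. -/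
lemma perm_induction (P : Equiv.Perm (Fin r) → Prop) (h1 : P 1)
    (hs : ∀ w k, w (loIdx k) < w (hiIdx k) → P w → P (w * simpleT k)) (w) : P w := by
  induction hn : len w using Nat.strong_induction_on generalizing w with
  | _ n ih =>
    by_cases hw : w = 1
    · rw [hw]; exact h1
    obtain ⟨k, hk⟩ := exists_descent w hw
    have hk' : (w * simpleT k) (loIdx k) < (w * simpleT k) (hiIdx k) := by
      simpa [simpleT_lo, simpleT_hi] using hk
    have hl := len_up _ _ hk'
    rw [mul_ss] at hl
    have := hs _ k hk' (ih _ (by omega) _ rfl)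
    rwa [mul_ss] at this

end
end HCPaper

namespace HCPaper

noncomputable section

variable {R : Type} [CommRing R] {q : R} {r : ℕ}

section TWsec
variable {TW : Equiv.Perm (Fin r) → HC R q r}

lemma ne_wk (w : Equiv.Perm (Fin r)) (k : Fin (r - 1)) : w (loIdx k) ≠ w (hiIdx k) := by
  simp [lo_ne_hi]

lemma TW_up (hTW : IsTW q r TW) (w : Equiv.Perm (Fin r)) (k : Fin (r - 1))
    (h : w (loIdx k) < w (hiIdx k)) : TW w * TT R q r k = TW (w * simpleT k) :=
  (hTW.2 w k (len_up w k h)).symm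

lemma TW_down (hTW : IsTW q r TW) (w : Equiv.Perm (Fin r)) (k : Fin (r - 1))
    (h : w (hiIdx k) < w (loIdx k)) :
    TW w * TT R q r k = q • TW (w * simpleT k) + (q - 1) • TW w := by
  have hk' : (w * simpleT k) (loIdx k) < (w * simpleT k) (hiIdx k) := by
    simpa [simpleT_lo, simpleT_hi] using h
  have e := TW_up hTW _ k hk'
  rw [mul_ss] at e
  rw [← e, mul_assoc, TT_quad, mul_add, mul_smul_comm, mul_smul_comm, mul_one]

/-- The map `f ↦ ∑ f(w) T_w`. -/
def psi (TW : Equiv.Perm (Fin r) → HC R q r) : VV R r →ₗ[R] HC R q r :=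
  ∑ w : Equiv.Perm (Fin r), (LinearMap.mulRight R (TW w)).comp
    ((io q r).toLinearMap.comp (LinearMap.proj w))

lemma psi_apply (f : VV R r) : psi TW f = ∑ w, io q r (f w) * TW w := by
  simp [psi]

lemma psi_single (w : Equiv.Perm (Fin r)) (c : Cl R r) :
    psi TW (Pi.single w c) = io q r c * TW w := by
  rw [psi_apply, Finset.sum_eq_single w]
  · simp
  · intro b _ hb
    simp [Pi.single_eq_of_ne hb]
  · simp

lemma psi_smul (c : Cl R r) (f : VV R r) : psi TW (c • f) = io q r c * psi TW f := by
  simp only [psi_apply, Finset.mul_sum, Pi.smul_apply, smul_eq_mul, map_mul, mul_assoc]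

/-- right multiplication by `T_k` on coefficient functions -/
def rT (q : R) (k : Fin (r - 1)) (f : VV R r) : VV R r := fun w =>
  if w (loIdx k) < w (hiIdx k) then q • f (w * simpleT k)
  else f (w * simpleT k) + (q - 1) • f w

lemma psi_mul_TT (hTW : IsTW q r TW) (k : Fin (r - 1)) (f : VV R r) :
    psi TW f * TT R q r k = psi TW (rT q k f) := by
  have e1 : psi TW f * TT R q r k = ∑ w, io q r (f w) *
      ((if w (loIdx k) < w (hiIdx k) then (1 : R) else q) • TW (w * simpleT k) +
       (if w (loIdx k) < w (hiIdx k) then (0 : R) else (q - 1)) • TW w) := by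
    rw [psi_apply, Finset.sum_mul]
    refine Finset.sum_congr rfl fun w _ => ?_
    rw [mul_assoc]
    congr 1
    split_ifs with h
    · rw [TW_up hTW w k h]; module
    · rw [TW_down hTW w k (lt_of_le_of_ne (not_lt.1 h) (ne_wk w k).symm)]
  have e2 : psi TW (rT q k f) = ∑ w, ((if w (loIdx k) < w (hiIdx k) then q else (1 : R)) •
      (io q r (f (w * simpleT k)) * TW w) +
      (if w (loIdx k) < w (hiIdx k) then (0 : R) else (q - 1)) • (io q r (f w) * TW w)) := by
    rw [psi_apply]
    refine Finset.sum_congr rfl fun w _ => ?_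
    unfold rT
    split_ifs with h
    · rw [map_smul, smul_mul_assoc]; module
    · rw [map_add, map_smul, add_mul, smul_mul_assoc]; module
  rw [e1, e2, Finset.sum_add_distrib]
  simp only [mul_add, mul_smul_comm]
  rw [Finset.sum_add_distrib]
  congr 1
  refine Fintype.sum_equiv (Equiv.mulRight (simpleT k)) _ _ fun w => ?_
  simp only [Equiv.coe_mulRight, mul_ss, Equiv.Perm.mul_apply, simpleT_lo, simpleT_hi]
  rcases lt_or_gt_of_ne (ne_wk w k) with h | h
  · simp only [h, h.not_gt, if_true, if_false]
  · simp only [h, h.not_gt, if_true, if_false]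

lemma psi_surj (hTW : IsTW q r TW) : Function.Surjective (psi TW) := by
  rw [← LinearMap.range_eq_top]
  set M := LinearMap.range (psi TW) with hM
  have hTWM : ∀ w, TW w ∈ M := fun w => ⟨Pi.single w 1, by rw [psi_single, map_one, one_mul]⟩
  have hl : ∀ c, ∀ z ∈ M, io q r c * z ∈ M := by
    rintro c _ ⟨f, rfl⟩
    exact ⟨c • f, psi_smul c f⟩
  have hr : ∀ k, ∀ z ∈ M, z * TT R q r k ∈ M := by
    rintro k _ ⟨f, rfl⟩
    exact ⟨rT q k f, (psi_mul_TT hTW k f).symm⟩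
  have hTC : ∀ w, ∀ j, TW w * CC R q r j ∈ M := by
    intro w
    induction w using perm_induction with
    | h1 =>
      intro j
      rw [hTW.1, one_mul, ← mul_one (CC R q r j), ← hTW.1, ← io_cg]
      exact hl _ _ (hTWM 1)
    | hs w k h ih =>
      intro j
      rw [← TW_up hTW w k h, mul_assoc]
      by_cases h1 : j = loIdx k
      · subst h1
        rw [TC_lo, ← mul_assoc]
        exact hr _ _ (ih _)
      by_cases h2 : j = hiIdx k
      · subst h2
        rw [TC_hi, mul_sub, mul_smul_comm, mul_sub, ← mul_assoc]
        exact M.sub_mem (hr _ _ (ih _)) (M.smul_mem _ (M.sub_mem (ih _) (ih _)))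
      rw [TC_comm k j (fun h => h1 (Fin.ext h)) (fun h => h2 (Fin.ext h)), ← mul_assoc]
      exact hr _ _ (ih _)
  rw [eq_top_iff]
  intro z _
  apply hc_induction M
  · rw [← hTW.1]; exact hTWM 1
  · exact hr
  · rintro j _ ⟨f, rfl⟩
    rw [psi_apply, Finset.sum_mul]
    refine M.sum_mem fun w _ => ?_
    rw [mul_assoc]
    exact hl _ _ (hTC w j)

lemma tOp_single (k : Fin (r - 1)) (v : Equiv.Perm (Fin r)) (h : v⁻¹ (loIdx k) < v⁻¹ (hiIdx k)) :
    tOp q k (Pi.single v (1 : Cl R r)) = Pi.single (simpleT k * v) 1 := by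
  have e : (Pi.single v (1 : Cl R r) : VV R r) = baseV (Pi.single v 1) := by
    ext w
    by_cases hw : w = v
    · subst hw; simp [baseV]
    · simp [baseV, Pi.single_eq_of_ne hw]
  rw [e, tOp_base]
  ext w
  simp only [baseV, tB]
  have hss : simpleT k * (simpleT k * w) = w := by rw [← mul_assoc, simpleT_mul_self, one_mul]
  have hss' : simpleT k * (simpleT k * v) = v := by rw [← mul_assoc, simpleT_mul_self, one_mul]
  by_cases h1 : w = simpleT k * v
  · subst h1
    have hne : simpleT k * v ≠ v := by
      intro h0
      have h0' : simpleT k = 1 := by simpa using h0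
      have := simpleT_lo k
      rw [h0'] at this
      exact lo_ne_hi k this
    simp only [mul_inv_rev, Equiv.Perm.mul_apply, simpleT_inv, simpleT_lo, simpleT_hi, h.not_gt,
      if_false, hss', Pi.single_eq_same, Pi.single_eq_of_ne hne]
    simp
  · have h2 : simpleT k * w ≠ v := by
      rintro rfl
      exact h1 hss.symm
    rw [Pi.single_eq_of_ne h1, Pi.single_eq_of_ne h2]
    by_cases h3 : w = v
    · subst h3; rw [if_pos h]; simp
    · rw [Pi.single_eq_of_ne h3]; simp

lemma rho_TW (hTW : IsTW q r TW) (w : Equiv.Perm (Fin r)) : ∀ v : Equiv.Perm (Fin r),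
    (∀ x y, x < y → w y < w x → v⁻¹ x < v⁻¹ y) →
    rho q r (TW w) (Pi.single v 1) = Pi.single (w * v) 1 := by
  induction w using perm_induction with
  | h1 =>
    intro v _
    rw [hTW.1, map_one, one_mul]
    rfl
  | hs w k h ih =>
    intro v hv
    have hv' : v⁻¹ (loIdx k) < v⁻¹ (hiIdx k) := by
      apply hv
      · simp [loIdx, hiIdx, Fin.lt_def]
      · simpa [simpleT_lo, simpleT_hi] using h
    rw [← TW_up hTW w k h, map_mul, Module.End.mul_apply, rho_TT, tOp_single k v hv', ih, mul_assoc]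
    intro x y hxy hw
    rw [mul_inv_rev, simpleT_inv, Equiv.Perm.mul_apply, Equiv.Perm.mul_apply]
    have hss : ∀ x, simpleT k (simpleT k x) = x := fun x => by simp [simpleT]
    apply hv
    · apply simpleT_lt k hxy
      rintro ⟨rfl, rfl⟩
      exact absurd hw h.not_gt
    · simpa [hss] using hw

lemma psi_inj (hTW : IsTW q r TW) : Function.Injective (psi TW) := by
  apply Function.LeftInverse.injective (g := fun z => rho q r z (Pi.single 1 1))
  intro f
  simp only [psi_apply, map_sum, map_mul, LinearMap.sum_apply, Module.End.mul_apply, rho_io]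
  have : ∀ w, rho q r (TW w) (Pi.single 1 1) = Pi.single w 1 := by
    intro w
    rw [rho_TW hTW w 1, mul_one]
    intro x y h _
    simpa using h
  simp only [this]
  ext v
  rw [Finset.sum_apply, Finset.sum_eq_single v]
  · simp
  · intro b _ hb
    simp [Pi.single_eq_of_ne hb.symm]
  · simp

/-! ### Young subgroups, through a monotone block function -/

section young
variable {n : ℕ} (blk : Fin r → Fin n) 

def Yg (blk : Fin r → Fin n) (w : Equiv.Perm (Fin r)) : Prop := ∀ j, blk (w j) = blk j

variable {blk}

lemma Yg_mul_simple {k : Fin (r - 1)} (hk : blk (loIdx k) = blk (hiIdx k))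
    (w : Equiv.Perm (Fin r)) : Yg blk (w * simpleT k) ↔ Yg blk w := by
  have hs : ∀ j, blk (simpleT k j) = blk j := by
    intro j
    by_cases h1 : j = loIdx k
    · subst h1; rw [simpleT_lo, hk]
    by_cases h2 : j = hiIdx k
    · subst h2; rw [simpleT_hi, hk]
    rw [simpleT_ne k h1 h2]
  have hss : ∀ x, simpleT k (simpleT k x) = x := fun x => by simp [simpleT]
  constructor
  · intro h j
    have := h (simpleT k j)
    rwa [Equiv.Perm.mul_apply, hss, hs] at this
  · intro h j
    rw [Equiv.Perm.mul_apply, h, hs]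

lemma Yg_descent (hb : Monotone blk) {u : Equiv.Perm (Fin r)} (hu : Yg blk u) {k : Fin (r - 1)}
    (h : u (hiIdx k) < u (loIdx k)) : blk (loIdx k) = blk (hiIdx k) := by
  apply le_antisymm
  · apply hb; simp [loIdx, hiIdx, Fin.le_def]
  · have := hb h.le
    rwa [hu, hu] at this

lemma Yg_induction (hb : Monotone blk) (P : Equiv.Perm (Fin r) → Prop) (h1 : P 1)
    (hs : ∀ w k, Yg blk w → blk (loIdx k) = blk (hiIdx k) → w (loIdx k) < w (hiIdx k) →
      P w → P (w * simpleT k)) (w) (hw : Yg blk w) : P w := by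
  induction w using perm_induction with
  | h1 => exact h1
  | hs w k h ih =>
    have hk : blk (loIdx k) = blk (hiIdx k) :=
      Yg_descent hb hw (by simpa [simpleT_lo, simpleT_hi] using h)
    have hw' := (Yg_mul_simple hk w).1 hw
    exact hs w k hw' hk h (ih hw')

/-- minimal coset representatives -/
def Dm (blk : Fin r → Fin n) (d : Equiv.Perm (Fin r)) : Prop :=
  ∀ k : Fin (r - 1), blk (loIdx k) = blk (hiIdx k) → d (loIdx k) < d (hiIdx k)

lemma Dm_lt (hb : Monotone blk) {d : Equiv.Perm (Fin r)} (hd : Dm blk d) :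
    ∀ x y : Fin r, x < y → blk x = blk y → d x < d y := by
  intro x y hxy hbxy
  have key : ∀ m : ℕ, ∀ y : Fin r, y.val = x.val + m + 1 → blk x = blk y → d x < d y := by
    intro m
    induction m with
    | zero =>
      intro y hy hbl
      obtain ⟨k, hkx⟩ : ∃ k : Fin (r - 1), k.val = x.val := ⟨⟨x.val, by omega⟩, rfl⟩
      have hx : x = loIdx k := Fin.ext hkx.symm
      have hy' : y = hiIdx k := Fin.ext (by simp only [hiIdx]; omega)
      rw [hx, hy'] at hbl ⊢
      exact hd _ hbl
    | succ m ih =>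
      intro y hy hbl
      let k : Fin (r - 1) := ⟨x.val + m + 1, by omega⟩
      have hy' : y = hiIdx k := Fin.ext (by simp [hiIdx, k]; omega)
      have b1 : blk x ≤ blk (loIdx k) := hb (by simp [loIdx, k, Fin.le_def]; omega)
      have b2 : blk (loIdx k) ≤ blk (hiIdx k) := hb (by simp [loIdx, hiIdx, Fin.le_def])
      rw [hy'] at hbl ⊢
      have b3 : blk x = blk (loIdx k) := le_antisymm b1 (hbl ▸ b2)
      exact (ih (loIdx k) rfl b3).trans (hd k (b3 ▸ hbl))
  exact key (y.val - x.val - 1) y (by have := Fin.lt_def.1 hxy; omega) hbxy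

lemma TW_mul (hTW : IsTW q r TW) (hb : Monotone blk) {d : Equiv.Perm (Fin r)} (hd : Dm blk d)
    (u : Equiv.Perm (Fin r)) (hu : Yg blk u) : TW d * TW u = TW (d * u) := by
  refine Yg_induction hb (fun u => TW d * TW u = TW (d * u)) ?_ ?_ u hu
  · rw [hTW.1, mul_one, mul_one]
  · intro w k hw hk h ih
    rw [← TW_up hTW w k h, ← mul_assoc, ih, ← mul_assoc]
    apply TW_up hTW
    exact Dm_lt hb hd _ _ h (by rw [hw, hw, hk])

lemma exists_decomp (w : Equiv.Perm (Fin r)) : ∃ d u, Dm blk d ∧ Yg blk u ∧ d * u = w := by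
  induction hn : len w using Nat.strong_induction_on generalizing w with
  | _ N ih =>
    by_cases hw : Dm blk w
    · exact ⟨w, 1, hw, fun _ => rfl, mul_one _⟩
    unfold Dm at hw
    push Not at hw
    obtain ⟨k, hk, h⟩ := hw
    have h := lt_of_le_of_ne h (ne_wk w k).symm
    have hk' : (w * simpleT k) (loIdx k) < (w * simpleT k) (hiIdx k) := by
      simpa [simpleT_lo, simpleT_hi] using h
    have hl := len_up _ _ hk'
    rw [mul_ss] at hl
    obtain ⟨d, u, hd, hu, e⟩ := ih _ (by omega) (w * simpleT k) rfl
    exact ⟨d, u * simpleT k, hd, (Yg_mul_simple hk u).2 hu, by rw [← mul_assoc, e, mul_ss]⟩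

lemma decomp_unique (hb : Monotone blk) {d d' u u' : Equiv.Perm (Fin r)} (hd : Dm blk d)
    (hd' : Dm blk d') (hu : Yg blk u) (hu' : Yg blk u') (h : d * u = d' * u') :
    d = d' ∧ u = u' := by
  have hv : Yg blk (u' * u⁻¹) := by
    intro j
    rw [Equiv.Perm.mul_apply, hu', ← hu (u⁻¹ j)]
    simp
  have e : d = d' * (u' * u⁻¹) := by rw [← mul_assoc, ← h]; group
  by_cases h1 : u' * u⁻¹ = 1
  · refine ⟨by rw [e, h1, mul_one], (mul_inv_eq_one.1 h1).symm⟩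
  exfalso
  obtain ⟨k, hk⟩ := exists_descent _ h1
  have hkb := Yg_descent hb hv hk
  have := Dm_lt hb hd' _ _ hk (by rw [hv, hv, hkb])
  have h2 := hd k hkb
  rw [e] at h2
  exact absurd h2 this.not_gt

open Classical in
def xB (blk : Fin r → Fin n) (TW : Equiv.Perm (Fin r) → HC R q r) : HC R q r :=
  ∑ w, if Yg blk w then TW w else 0

open Classical in
lemma xB_psi : xB blk TW = psi TW (fun w => if Yg blk w then 1 else 0) := by
  rw [psi_apply, xB]
  refine Finset.sum_congr rfl fun w _ => ?_
  split_ifs <;> simp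

lemma xB_mul (hTW : IsTW q r TW) (k : Fin (r - 1)) (hk : blk (loIdx k) = blk (hiIdx k)) :
    xB blk TW * TT R q r k = q • xB blk TW := by
  rw [xB_psi, psi_mul_TT hTW, ← map_smul]
  congr 1
  ext w
  have e := Yg_mul_simple hk w
  simp only [rT, Pi.smul_apply]
  by_cases h : Yg blk w
  · rw [if_pos h, if_pos (e.2 h)]
    split_ifs <;> module
  · rw [if_neg h, if_neg (fun h' => h (e.1 h'))]
    split_ifs <;> module

lemma smul_cancel_aux {M : Type} [AddCommGroup M] [Module R M] (q : R) (x y : M)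
    (h : x + (q - 1) • y = q • y) : x = y := by
  rw [eq_sub_of_add_eq h]
  module

lemma main_div (hTW : IsTW q r TW) (hb : Monotone blk) (z : HC R q r)
    (hz : ∀ k : Fin (r - 1), blk (loIdx k) = blk (hiIdx k) → z * TT R q r k = q • z) :
    ∃ h, z = h * xB blk TW := by
  classical
  obtain ⟨f, rfl⟩ := psi_surj hTW z
  have h1 : ∀ k : Fin (r - 1), blk (loIdx k) = blk (hiIdx k) → ∀ w, f (w * simpleT k) = f w := by
    intro k hk
    have e := hz k hk
    rw [psi_mul_TT hTW, ← map_smul] at e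
    have e := psi_inj hTW e
    have down : ∀ w : Equiv.Perm (Fin r), w (hiIdx k) < w (loIdx k) →
        f (w * simpleT k) = f w := by
      intro w hw
      have e' := congrFun e w
      simp only [rT, hw.not_gt, if_false, Pi.smul_apply] at e'
      exact smul_cancel_aux q _ _ e'
    intro w
    rcases lt_or_gt_of_ne (ne_wk w k) with h | h
    · have := down (w * simpleT k) (by simpa [simpleT_lo, simpleT_hi] using h)
      rw [mul_ss] at this
      exact this.symm
    · exact down w h
  have h2 : ∀ u, Yg blk u → ∀ w, f (w * u) = f w := by
    intro u hu
    refine Yg_induction hb (fun u => ∀ w, f (w * u) = f w) ?_ ?_ u hu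
    · intro w; rw [mul_one]
    · intro v k hv hk h ih w
      rw [← mul_assoc, h1 k hk, ih]
  refine ⟨∑ d ∈ Finset.univ.filter (Dm blk), io q r (f d) * TW d, ?_⟩
  rw [xB, ← Finset.sum_filter, Finset.sum_mul_sum, ← Finset.sum_product', psi_apply]
  symm
  refine Finset.sum_nbij (fun p => p.1 * p.2) ?_ ?_ ?_ ?_
  · intro p _; exact Finset.mem_univ _
  · rintro ⟨d, u⟩ hp ⟨d', u'⟩ hp' h
    simp only [Finset.coe_product, Finset.coe_filter, Finset.mem_univ, true_and, Set.mem_prod,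
      Set.mem_ofPred_eq] at hp hp'
    obtain ⟨a, b⟩ := decomp_unique hb hp.1 hp'.1 hp.2 hp'.2 h
    rw [a, b]
  · intro w _
    obtain ⟨d, u, hd, hu, e⟩ := exists_decomp (blk := blk) w
    exact ⟨(d, u), by simp [hd, hu], e⟩
  · rintro ⟨d, u⟩ hp
    simp only [Finset.mem_product, Finset.mem_filter, Finset.mem_univ, true_and] at hp
    simp only
    rw [mul_assoc, TW_mul hTW hb hp.1 u hp.2, h2 u hp.2]

end young

end TWsec

/-! ### Blocks of a composition -/

lemma psum_succ {n : ℕ} (lam : Fin n → ℕ) (m : ℕ) (hm : m < n) :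
    psum lam (m + 1) = psum lam m + lam ⟨m, hm⟩ := by
  unfold psum
  have : ∀ i : Fin n, (if (i : ℕ) < m + 1 then lam i else 0) =
      (if (i : ℕ) < m then lam i else 0) + (if i = ⟨m, hm⟩ then lam i else 0) := by
    intro i
    simp only [Fin.ext_iff]
    split_ifs <;> omega
  rw [Finset.sum_congr rfl fun i _ => this i, Finset.sum_add_distrib]
  simp

lemma psum_mono {n : ℕ} (lam : Fin n → ℕ) : Monotone (psum lam) := by
  intro a b hab
  unfold psum
  refine Finset.sum_le_sum fun i _ => ?_
  split_ifs <;> omega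

lemma exists_blk {n r : ℕ} (lam : Fin n → ℕ) (h : ∑ i, lam i = r) :
    ∃ blk : Fin r → Fin n, Monotone blk ∧ ∀ j b, InBlock lam b j ↔ blk j = b := by
  have ex : ∀ m ≤ n, ∀ j : Fin r, j.val < psum lam m → ∃ b, InBlock lam b j := by
    intro m
    induction m with
    | zero => intro _ j hj; simp [psum] at hj
    | succ m ih =>
      intro hm j hj
      by_cases hjm : j.val < psum lam m
      · exact ih (by omega) j hjm
      · rw [psum_succ lam m hm] at hj
        exact ⟨⟨m, hm⟩, not_lt.1 hjm, hj⟩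
  have tot : psum lam n = r := by
    rw [← h]; unfold psum
    exact Finset.sum_congr rfl fun i _ => by simp
  have ord : ∀ a b : Fin n, ∀ x y : Fin r, InBlock lam a x → InBlock lam b y → a < b → x < y := by
    intro a b x y hx hy hab
    have h1 := psum_mono lam (show a.val + 1 ≤ b.val from hab)
    rw [psum_succ lam a a.isLt] at h1
    have h2 := hx.2
    have h3 := hy.1
    rw [Fin.lt_def]
    simp only [Fin.eta] at h1
    omega
  have ex' : ∀ j : Fin r, ∃ b, InBlock lam b j := fun j => ex n le_rfl j (by rw [tot]; exact j.isLt)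
  choose blk hblk using ex'
  refine ⟨blk, ?_, ?_⟩
  · intro x y hxy
    by_contra hc
    exact absurd (ord _ _ _ _ (hblk y) (hblk x) (not_le.1 hc)) hxy.not_gt
  · intro j b
    constructor
    · intro hb
      rcases lt_trichotomy (blk j) b with h | h | h
      · exact absurd (ord _ _ _ _ (hblk j) hb h) (lt_irrefl _)
      · exact h
      · exact absurd (ord _ _ _ _ hb (hblk j) h) (lt_irrefl _)
    · rintro rfl; exact hblk j

lemma xElt_eq {n : ℕ} (lam : Fin n → ℕ) (h : ∑ i, lam i = r)
    (TW : Equiv.Perm (Fin r) → HC R q r) :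
    ∃ blk : Fin r → Fin n, Monotone blk ∧ xElt lam TW = xB blk TW := by
  classical
  obtain ⟨blk, hb, hh⟩ := exists_blk lam h
  refine ⟨blk, hb, ?_⟩
  unfold xElt xB
  refine Finset.sum_congr rfl fun w _ => ?_
  have : MemYoung lam w ↔ Yg blk w := by
    unfold MemYoung Yg
    simp only [hh]
    exact ⟨fun h j => h _ j rfl, fun h k j e => (h j).trans e⟩
  simp only [this]

end
end HCPaper

open HCPaper MulOpposite in
/-- The `R`-module isomorphism
`Hom_{H^c}(x_μ H^c, x_λ H^c) ≅ x_λ H^c ∩ H^c x_μ`, `f ↦ f(x_μ)`: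
(1) evaluation at `x_μ` of any right-module homomorphism `x_μ H^c → x_λ H^c` lands in
`x_λ H^c ∩ H^c x_μ`; (2) for each `z` in the intersection there is a unique such
homomorphism with `x_μ h ↦ z h`. Right `H^c`-modules are `(H^c)ᵐᵒᵖ`-modules. -/
theorem stmt15 (R : Type) [CommRing R] (h2 : ringChar R ≠ 2) (q : R) (r n : ℕ)
    (lam mu : Fin n → ℕ) (hlam : ∑ i, lam i = r) (hmu : ∑ i, mu i = r)
    (TW : Equiv.Perm (Fin r) → HC R q r) (hTW : IsTW q r TW) :
    (∀ f : (Submodule.span (HC R q r)ᵐᵒᵖ {xElt mu TW} :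
            Submodule (HC R q r)ᵐᵒᵖ (HC R q r)) →ₗ[(HC R q r)ᵐᵒᵖ] HC R q r,
      LinearMap.range f ≤ Submodule.span (HC R q r)ᵐᵒᵖ {xElt lam TW} →
      (∃ h, f ⟨xElt mu TW, Submodule.mem_span_singleton_self _⟩ = xElt lam TW * h) ∧
      (∃ h, f ⟨xElt mu TW, Submodule.mem_span_singleton_self _⟩ = h * xElt mu TW)) ∧
    (∀ z : HC R q r, (∃ h, z = xElt lam TW * h) → (∃ h, z = h * xElt mu TW) →
      ∃! f : (Submodule.span (HC R q r)ᵐᵒᵖ {xElt mu TW} :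
              Submodule (HC R q r)ᵐᵒᵖ (HC R q r)) →ₗ[(HC R q r)ᵐᵒᵖ] HC R q r,
        LinearMap.range f ≤ Submodule.span (HC R q r)ᵐᵒᵖ {xElt lam TW} ∧
        ∀ h : HC R q r,
          f ⟨xElt mu TW * h,
              Submodule.mem_span_singleton.mpr ⟨op h, op_smul_eq_mul ..⟩⟩ = z * h) := by
  classical
  have hspan : ∀ (x y : HC R q r), y ∈ (Submodule.span (HC R q r)ᵐᵒᵖ {x} :
      Submodule (HC R q r)ᵐᵒᵖ (HC R q r)) → ∃ h, y = x * h := by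
    intro x y hy
    obtain ⟨a, ha⟩ := Submodule.mem_span_singleton.1 hy
    exact ⟨unop a, by rw [← ha]; rfl⟩
  have hspan' : ∀ (x h : HC R q r), x * h ∈ (Submodule.span (HC R q r)ᵐᵒᵖ {x} :
      Submodule (HC R q r)ᵐᵒᵖ (HC R q r)) := fun x h =>
    Submodule.mem_span_singleton.mpr ⟨op h, op_smul_eq_mul ..⟩
  refine ⟨?_, ?_⟩
  · intro f hf
    refine ⟨hspan _ _ (hf ⟨_, rfl⟩), ?_⟩
    obtain ⟨blk, hb, hx⟩ := xElt_eq mu hmu TW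
    have := main_div (blk := blk) hTW hb (f ⟨xElt mu TW, Submodule.mem_span_singleton_self _⟩) ?_
    · rw [← hx] at this
      exact this
    intro k hk
    have e := xB_mul (blk := blk) hTW k hk
    rw [← hx] at e
    have e1 : (op (TT R q r k)) • (⟨xElt mu TW, Submodule.mem_span_singleton_self _⟩ :
        (Submodule.span (HC R q r)ᵐᵒᵖ {xElt mu TW} : Submodule (HC R q r)ᵐᵒᵖ (HC R q r))) =
        (op (algebraMap R (HC R q r) q)) • ⟨xElt mu TW, Submodule.mem_span_singleton_self _⟩ := by
      apply Subtype.ext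
      change xElt mu TW * TT R q r k = xElt mu TW * algebraMap R (HC R q r) q
      rw [e, Algebra.smul_def, Algebra.commutes]
    have e2 := congrArg f e1
    rw [map_smul, map_smul, op_smul_eq_mul, op_smul_eq_mul] at e2
    rw [e2, Algebra.smul_def, Algebra.commutes]
  · rintro z ⟨a, ha⟩ ⟨b, hb⟩
    let L : HC R q r →ₗ[(HC R q r)ᵐᵒᵖ] HC R q r :=
      { toFun := fun y => b * y
        map_add' := fun x y => mul_add b x y
        map_smul' := fun c y => by
          change b * (y * unop c) = b * y * unop c
          rw [mul_assoc] }
    refine ⟨L.comp (Submodule.subtype _), ⟨?_, ?_⟩, ?_⟩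
    · rintro _ ⟨⟨y, hy⟩, rfl⟩
      obtain ⟨h, rfl⟩ := hspan _ _ hy
      change b * (xElt mu TW * h) ∈ _
      rw [← mul_assoc, ← hb, ha, mul_assoc]
      exact hspan' _ _
    · intro h
      change b * (xElt mu TW * h) = z * h
      rw [hb, mul_assoc]
    · rintro g ⟨_, hg⟩
      refine LinearMap.ext ?_
      rintro ⟨y, hy⟩
      obtain ⟨h, rfl⟩ := hspan _ _ hy
      rw [hg]
      change z * h = b * (xElt mu TW * h)
      rw [hb, mul_assoc]
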